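/- arXiv:1609.01035 — 6 statements merged into one kernel-verified Lean document; each statement's English description precedes it below -/
import Mathlib

section
/- Explicit subsolution for the damped ODE (Lemma 2.2): Let β ∈ [-1,1], p > 1, A₀ > 0 and ε₀ ∈ (0,1]. Let b satisfy the damping assumptions with constants b₁, b₂, b₃, and if β > 0 assume additionally that B⁻¹(τ) ≤ B₄(1+τ)^{1/(1+β)} for all τ ≥ 0 for some constant B₄ > 0. Let μ = μ(p,b,β,A₀) and set T₁ = B⁻¹(μ⁻¹ ε₀^{1-p}). Define g(t) = ε₀ (1 − μ ε₀^{p-1} B(t))^{−2/(p−1)} for t ∈ [0,T₁). Then g(0) = ε₀, g'(0) ≤ A₀ ε₀, and g''(t) + b(t) g'(t) ≤ g(t)^p for all t ∈ [0,T₁). -/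
open Set

/-- The constant μ(p,b,β,A) from the paper, where `b0 = b(0)` and
`K = (2^{1/(1+β)}(1+B₄))^{2β}` if `β > 0` and `K = 1` if `β ≤ 0`. -/
noncomputable def dampMu (p b0 β b₁ b₃ B₄ A : ℝ) : ℝ :=
  min 1 (min ((p - 1) / 2 * b0 * A)
    ((2 * (p + 1) / (p - 1) ^ 2 * b₁ ^ (-(2:ℝ)) *
        (if 0 < β then ((2:ℝ) ^ (1 / (1 + β)) * (1 + B₄)) ^ (2 * β) else 1) +
      2 * (b₁⁻¹ * b₃ + 1) / (p - 1))⁻¹))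

/-- One-sided fundamental theorem of calculus on `[0, ∞)` for a continuous integrand. -/
lemma hasDerivWithinAt_Ici_of_eq_integral {f F : ℝ → ℝ} (hf : ContinuousOn f (Ici 0))
    (hF : ∀ t ≥ (0:ℝ), F t = ∫ τ in (0:ℝ)..t, f τ) {t : ℝ} (ht : 0 ≤ t) :
    HasDerivWithinAt F (f t) (Ici 0) t := by
  have hc : Continuous fun x => f (max x 0) :=
    hf.comp_continuous (by fun_prop) fun x => le_max_right x 0
  have h := (hc.integral_hasStrictDerivAt 0 t).hasDerivAt.hasDerivWithinAt (s := Ici 0)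
  simp only [max_eq_left ht] at h
  have hFeq : ∀ x ∈ Ici (0:ℝ), F x = ∫ τ in (0:ℝ)..x, f (max τ 0) := by
    intro x hx
    rw [hF x hx]
    refine intervalIntegral.integral_congr fun y hy => ?_
    rw [uIcc_of_le hx] at hy
    simp only [max_eq_left hy.1]
  exact h.congr hFeq (hFeq t ht)

/-- Polynomial growth of `t` in terms of `δ⁻¹`, at the exponent `1 / (1 + β)`, bounds
`δ * (1 + t) ^ (2 * β)`. -/
lemma mul_one_add_rpow_le {β B₄ δ t : ℝ} (hβ : 0 < β) (hβ1 : β ≤ 1) (hB₄ : 0 < B₄)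
    (hδ : 0 < δ) (hδ1 : δ ≤ 1) (ht : 0 ≤ t)
    (htle : t ≤ B₄ * (1 + δ⁻¹) ^ (1 / (1 + β))) :
    δ * (1 + t) ^ (2 * β) ≤ ((2:ℝ) ^ (1 / (1 + β)) * (1 + B₄)) ^ (2 * β) := by
  have hs : 1 ≤ δ⁻¹ := (one_le_inv₀ hδ).2 hδ1
  have hs0 : 0 < δ⁻¹ := by positivity
  have h1 : (1 + δ⁻¹) ^ (1 / (1 + β)) ≤ (2 * δ⁻¹) ^ (1 / (1 + β)) :=
    Real.rpow_le_rpow (by positivity) (by linarith) (by positivity)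
  have h2 : 1 ≤ (2 * δ⁻¹) ^ (1 / (1 + β)) :=
    Real.one_le_rpow (by linarith) (by positivity)
  have h3 : 1 + t ≤ (2:ℝ) ^ (1 / (1 + β)) * (1 + B₄) * δ⁻¹ ^ (1 / (1 + β)) := by
    rw [Real.mul_rpow (by norm_num) hs0.le] at h1 h2
    nlinarith [mul_le_mul_of_nonneg_left h1 hB₄.le]
  have h4 : (δ⁻¹ ^ (1 / (1 + β))) ^ (2 * β) ≤ δ⁻¹ := by
    rw [← Real.rpow_mul hs0.le]
    refine Real.rpow_le_self_of_one_le hs ?_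
    rw [one_div_mul_eq_div, div_le_one (by positivity)]
    linarith
  calc δ * (1 + t) ^ (2 * β)
      ≤ δ * ((2:ℝ) ^ (1 / (1 + β)) * (1 + B₄) * δ⁻¹ ^ (1 / (1 + β))) ^ (2 * β) := by gcongr
    _ = δ * (((2:ℝ) ^ (1 / (1 + β)) * (1 + B₄)) ^ (2 * β) *
          (δ⁻¹ ^ (1 / (1 + β))) ^ (2 * β)) := by
        rw [Real.mul_rpow (by positivity) (by positivity)]
    _ ≤ δ * (((2:ℝ) ^ (1 / (1 + β)) * (1 + B₄)) ^ (2 * β) * δ⁻¹) := by gcongr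
    _ = _ := by field_simp

lemma inv_le_inv_mul_rpow_of_mul_rpow_neg_le {β b₁ x t : ℝ} (hb₁ : 0 < b₁) (ht : 0 ≤ t)
    (hx : b₁ * (1 + t) ^ (-β) ≤ x) : x⁻¹ ≤ b₁⁻¹ * (1 + t) ^ β := by
  have h0 : 0 < 1 + t := by linarith
  calc x⁻¹ ≤ (b₁ * (1 + t) ^ (-β))⁻¹ := inv_anti₀ (by positivity) hx
    _ = _ := by rw [Real.rpow_neg h0.le, mul_inv, inv_inv]

/-- The parameter inequality that makes `ε * h ^ (-q)` a subsolution, `q = 2 / (p - 1)`. -/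
lemma subsolution_coeff_le {q L M N μ δ h x x' : ℝ} (hq : 0 < q) (hμ : 0 < μ)
    (hh : 0 < h) (hh1 : h ≤ 1) (hN : 0 ≤ N) (hδ : δ * x⁻¹ ^ 2 ≤ L)
    (hx' : 1 - x' * x⁻¹ ^ 2 ≤ N) (hM : M = q * (q + 1) * L + q * N) (hμM : μ * M ≤ 1) :
    μ * (q * (q + 1) * (δ * x⁻¹ ^ 2)) + μ * (q * (h * (1 - x' * x⁻¹ ^ 2))) ≤ 1 := by
  have h1 : h * (1 - x' * x⁻¹ ^ 2) ≤ N := by nlinarith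
  calc _ ≤ μ * (q * (q + 1) * L) + μ * (q * N) := by gcongr
    _ = μ * M := by rw [hM]; ring
    _ ≤ 1 := hμM

/-- Explicit subsolution for the damped ODE (Lemma 2.2). -/
theorem explicit_subsolution (β p A₀ ε₀ b₁ b₂ b₃ B₄ : ℝ)
    (hβ : β ∈ Icc (-1:ℝ) 1) (hp : 1 < p) (hA₀ : 0 < A₀) (hε₀ : ε₀ ∈ Ioc (0:ℝ) 1)
    (hb₁ : 0 < b₁) (hb₂ : 0 < b₂) (hb₃ : 0 < b₃) (hB₄ : 0 < B₄)
    (b b' B Binv : ℝ → ℝ)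
    (hbpos : ∀ t ≥ (0:ℝ), 0 < b t)
    (hbder : ∀ t ≥ (0:ℝ), HasDerivWithinAt b (b' t) (Ici 0) t)
    (hblow : ∀ t ≥ (0:ℝ), b₁ * (1 + t) ^ (-β) ≤ b t)
    (hbupp : ∀ t ≥ (0:ℝ), b t ≤ b₂ * (1 + t) ^ (-β))
    (hb'bound : ∀ t ≥ (0:ℝ), |b' t| ≤ b₃ * (1 + t)⁻¹ * b t)
    (hB : ∀ t ≥ (0:ℝ), B t = ∫ τ in (0:ℝ)..t, (b τ)⁻¹)
    (hBmono : StrictMonoOn B (Ici 0))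
    (hBinv_left : ∀ t ≥ (0:ℝ), Binv (B t) = t)
    (hBinv_right : ∀ τ ≥ (0:ℝ), 0 ≤ Binv τ ∧ B (Binv τ) = τ)
    (hBinv_bound : 0 < β → ∀ τ ≥ (0:ℝ), Binv τ ≤ B₄ * (1 + τ) ^ (1 / (1 + β)))
    (μ T₁ : ℝ) (g : ℝ → ℝ)
    (hμ : μ = dampMu p (b 0) β b₁ b₃ B₄ A₀)
    (hT₁ : T₁ = Binv (μ⁻¹ * ε₀ ^ (1 - p)))
    (hg : ∀ t, g t = ε₀ * (1 - μ * ε₀ ^ (p - 1) * B t) ^ (-(2 / (p - 1)))) :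
    g 0 = ε₀ ∧
    derivWithin g (Ici 0) 0 ≤ A₀ * ε₀ ∧
    ∀ t ∈ Ico (0:ℝ) T₁,
      derivWithin (derivWithin g (Ici 0)) (Ici 0) t + b t * derivWithin g (Ici 0) t
        ≤ g t ^ p := by
  obtain ⟨hε0, hε1⟩ := hε₀
  have hp1 : 0 < p - 1 := by linarith
  set q : ℝ := 2 / (p - 1) with hq
  have hq0 : 0 < q := by positivity
  set K : ℝ := if 0 < β then ((2:ℝ) ^ (1 / (1 + β)) * (1 + B₄)) ^ (2 * β) else 1 with hK
  have hK0 : 0 < K := by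
    rw [hK]; split_ifs <;> positivity
  set M : ℝ := 2 * (p + 1) / (p - 1) ^ 2 * b₁ ^ (-(2:ℝ)) * K +
    2 * (b₁⁻¹ * b₃ + 1) / (p - 1) with hMdef
  have hM0 : 0 < M := by positivity
  have hM : M = q * (q + 1) * (b₁⁻¹ ^ 2 * K) + q * (1 + b₁⁻¹ * b₃) := by
    have h2 : b₁ ^ (-(2:ℝ)) = b₁⁻¹ ^ 2 := by
      rw [Real.rpow_neg hb₁.le, inv_pow]; norm_cast
    rw [hMdef, h2, hq]
    field_simp
    ring
  have hb0 : 0 < b 0 := hbpos 0 le_rfl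
  have hμ' : μ = min 1 (min ((p - 1) / 2 * b 0 * A₀) M⁻¹) := hμ
  have hμ0 : 0 < μ := by
    rw [hμ']; exact lt_min one_pos (lt_min (by positivity) (by positivity))
  have hμ1 : μ ≤ 1 := hμ' ▸ min_le_left _ _
  have hμA : μ ≤ (p - 1) / 2 * b 0 * A₀ :=
    hμ' ▸ (min_le_right _ _).trans (min_le_left _ _)
  have hμM : μ * M ≤ 1 := by
    have h : μ ≤ M⁻¹ := hμ' ▸ (min_le_right _ _).trans (min_le_right _ _)
    calc μ * M ≤ M⁻¹ * M := by gcongr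
      _ = 1 := inv_mul_cancel₀ hM0.ne'
  set δ : ℝ := μ * ε₀ ^ (p - 1) with hδ
  have hεp0 : 0 < ε₀ ^ (p - 1) := Real.rpow_pos_of_pos hε0 _
  have hεp1 : ε₀ ^ (p - 1) ≤ 1 := Real.rpow_le_one hε0.le hε1 hp1.le
  have hδ0 : 0 < δ := by positivity
  have hδμ : δ ≤ μ := mul_le_of_le_one_right hμ0.le hεp1
  have hδ1 : δ ≤ 1 := hδμ.trans hμ1
  have hδinv : μ⁻¹ * ε₀ ^ (1 - p) = δ⁻¹ := by
    rw [hδ, mul_inv, ← Real.rpow_neg hε0.le, neg_sub]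
  rw [hδinv] at hT₁
  obtain ⟨hT0, hBT⟩ := hBinv_right δ⁻¹ (by positivity)
  rw [← hT₁] at hT0 hBT
  have hB0 : B 0 = 0 := by simp [hB 0 le_rfl]
  have hBnn : ∀ t ≥ (0:ℝ), 0 ≤ B t := fun t ht =>
    hB0 ▸ hBmono.monotoneOn self_mem_Ici ht ht
  have hbc : ContinuousOn b (Ici 0) := fun t ht => (hbder t ht).continuousWithinAt
  have hBder : ∀ t ≥ (0:ℝ), HasDerivWithinAt B (b t)⁻¹ (Ici 0) t := fun t ht =>
    hasDerivWithinAt_Ici_of_eq_integral (hbc.inv₀ fun x hx => (hbpos x hx).ne') hB ht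
  have hhpos : ∀ t ∈ Ico (0:ℝ) T₁, 0 < 1 - δ * B t := fun t ht => by
    have h : B t < δ⁻¹ := hBT ▸ hBmono ht.1 hT0 ht.2
    have : δ * B t < δ * δ⁻¹ := by gcongr
    rw [mul_inv_cancel₀ hδ0.ne'] at this
    linarith
  have hT0' : 0 < T₁ := by
    refine lt_of_le_of_ne hT0 fun h => ?_
    rw [← h, hB0] at hBT
    exact (inv_pos.2 hδ0).ne hBT
  have hpow : ∀ r, ∀ t ∈ Ico (0:ℝ) T₁, HasDerivWithinAt (fun t => (1 - δ * B t) ^ (-r))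
      (δ * r * (1 - δ * B t) ^ (-r - 1) * (b t)⁻¹) (Ici 0) t := fun r t ht => by
    refine ((((hBder t ht.1).const_mul δ).const_sub 1).rpow_const
      (p := -r) (Or.inl (hhpos t ht).ne')).congr_deriv ?_
    ring
  have hgder : ∀ t ∈ Ico (0:ℝ) T₁, derivWithin g (Ici 0) t =
      ε₀ * (δ * q * (1 - δ * B t) ^ (-(q + 1)) * (b t)⁻¹) := fun t ht => by
    rw [funext hg, neg_add, ← sub_eq_add_neg]
    exact ((hpow q t ht).const_mul ε₀).derivWithin (uniqueDiffOn_Ici 0 t ht.1)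
  have hgder2 : ∀ t ∈ Ico (0:ℝ) T₁, derivWithin (derivWithin g (Ici 0)) (Ici 0) t =
      ε₀ * (δ * q * (δ * (q + 1) * (1 - δ * B t) ^ (-(q + 2)) * (b t)⁻¹) * (b t)⁻¹ +
        δ * q * (1 - δ * B t) ^ (-(q + 1)) * (-b' t / b t ^ 2)) := fun t ht => by
    have hev : derivWithin g (Ici 0) =ᶠ[nhdsWithin t (Ici 0)]
        fun t => ε₀ * (δ * q * (1 - δ * B t) ^ (-(q + 1)) * (b t)⁻¹) := by
      filter_upwards [self_mem_nhdsWithin, mem_nhdsWithin_of_mem_nhds (Iio_mem_nhds ht.2)]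
        with x hx hxT using hgder x ⟨hx, hxT⟩
    rw [hev.derivWithin_eq (hgder t ht)]
    have h := ((((hpow (q + 1) t ht).const_mul (δ * q)).mul
      ((hbder t ht.1).inv (hbpos t ht.1).ne')).const_mul ε₀)
    rw [show -(q + 1) - 1 = -(q + 2) by ring] at h
    exact h.derivWithin (uniqueDiffOn_Ici 0 t ht.1)
  refine ⟨by simp [hg, hB0], ?_, fun t ht => ?_⟩
  · rw [hgder 0 ⟨le_rfl, hT0'⟩, hB0, mul_zero, sub_zero, Real.one_rpow, mul_one, mul_comm]
    gcongr
    calc δ * q * (b 0)⁻¹ ≤ (p - 1) / 2 * b 0 * A₀ * q * (b 0)⁻¹ := by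
          gcongr; exact hδμ.trans hμA
      _ = A₀ := by rw [hq]; field_simp
  have hbt := hbpos t ht.1
  have hht := hhpos t ht
  have h1t : 0 < 1 + t := by linarith [ht.1]
  have hbinv := inv_le_inv_mul_rpow_of_mul_rpow_neg_le hb₁ ht.1 (hblow t ht.1)
  have hbinv0 : 0 < (b t)⁻¹ := by positivity
  have hL : δ * (b t)⁻¹ ^ 2 ≤ b₁⁻¹ ^ 2 * K := by
    have hδK : δ * (1 + t) ^ (2 * β) ≤ K := by
      rw [hK]
      split_ifs with h
      · refine mul_one_add_rpow_le h hβ.2 hB₄ hδ0 hδ1 ht.1 (ht.2.le.trans ?_)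
        exact hT₁ ▸ hBinv_bound h δ⁻¹ (by positivity)
      · refine mul_le_one₀ hδ1 (by positivity) ?_
        exact Real.rpow_le_one_of_one_le_of_nonpos (by linarith [ht.1]) (by linarith)
    calc δ * (b t)⁻¹ ^ 2 ≤ δ * (b₁⁻¹ * (1 + t) ^ β) ^ 2 := by gcongr
      _ = b₁⁻¹ ^ 2 * (δ * (1 + t) ^ (2 * β)) := by
        rw [two_mul, Real.rpow_add h1t]; ring
      _ ≤ _ := by gcongr
  have hN : 1 - b' t * (b t)⁻¹ ^ 2 ≤ 1 + b₁⁻¹ * b₃ := by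
    have h1 : -b' t ≤ b₃ * (1 + t)⁻¹ * b t := (neg_le_abs _).trans (hb'bound t ht.1)
    have h2 : (1 + t)⁻¹ * (1 + t) ^ β ≤ 1 := by
      rw [← Real.rpow_neg_one, ← Real.rpow_add h1t]
      exact Real.rpow_le_one_of_one_le_of_nonpos (by linarith [ht.1]) (by linarith [hβ.2])
    have h3 : -b' t * (b t)⁻¹ ^ 2 ≤ b₁⁻¹ * b₃ := by
      calc -b' t * (b t)⁻¹ ^ 2 ≤ b₃ * (1 + t)⁻¹ * b t * (b t)⁻¹ ^ 2 := by gcongr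
        _ = b₃ * (1 + t)⁻¹ * (b t)⁻¹ := by field_simp
        _ ≤ b₃ * (1 + t)⁻¹ * (b₁⁻¹ * (1 + t) ^ β) := by gcongr
        _ = b₁⁻¹ * b₃ * ((1 + t)⁻¹ * (1 + t) ^ β) := by ring
        _ ≤ b₁⁻¹ * b₃ * 1 := by gcongr
        _ = _ := mul_one _
    linarith
  have hh1 : 1 - δ * B t ≤ 1 := by
    linarith [mul_nonneg hδ0.le (hBnn t ht.1)]
  have key := subsolution_coeff_le hq0 hμ0 hht hh1 (by positivity) hL hN hM hμM
  have hqp : q * p = q + 2 := by rw [hq]; field_simp; ring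
  have hgp : g t ^ p = ε₀ * ε₀ ^ (p - 1) * (1 - δ * B t) ^ (-(q + 2)) := by
    rw [hg, Real.mul_rpow hε0.le (by positivity), ← Real.rpow_mul hht.le, neg_mul, hqp]
    congr 1
    rw [mul_comm, ← Real.rpow_add_one hε0.ne', sub_add_cancel]
  have hstep : (1 - δ * B t) ^ (-(q + 1)) = (1 - δ * B t) ^ (-(q + 2)) * (1 - δ * B t) := by
    rw [← Real.rpow_add_one hht.ne']; ring_nf
  rw [hgder2 t ht, hgder t ht, hgp, hstep]
  set h := 1 - δ * B t
  set P := h ^ (-(q + 2))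
  have hP : 0 < P := Real.rpow_pos_of_pos hht _
  have hδsq : δ * δ = ε₀ ^ (p - 1) * (μ * δ) := by rw [hδ]; ring
  calc _ = ε₀ * ε₀ ^ (p - 1) * P * (μ * (q * (q + 1) * (δ * (b t)⁻¹ ^ 2)) +
        μ * (q * (h * (1 - b' t * (b t)⁻¹ ^ 2)))) := by
        have hbb : b t * (b t)⁻¹ = 1 := mul_inv_cancel₀ hbt.ne'
        rw [div_eq_mul_inv, ← inv_pow]
        linear_combination (ε₀ * P * q * (q + 1) * (b t)⁻¹ ^ 2) * hδsq +
          ε₀ * δ * q * P * h * hbb +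
          (ε₀ * P * q * h * (1 - b' t * (b t)⁻¹ ^ 2)) * hδ
    _ ≤ ε₀ * ε₀ ^ (p - 1) * P * 1 := by gcongr
    _ = _ := mul_one _
end

section
/- Blow-up rate and lifespan bound for the damped ordinary differential inequality (Proposition 2.3): Let T₀ > 0, A₀ > 0, β ∈ [-1,1], p > 1, γ > 0 and ε₀ ∈ (0, γ^{−1/(p−1)}]. Let b satisfy the damping assumptions with constants b₁, b₂, b₃, and if β > 0 assume additionally that B⁻¹(τ) ≤ B₄(1+τ)^{1/(1+β)} for all τ ≥ 0 for some constant B₄ > 0. Assume f : [0,T₀) → ℝ is twice continuously differentiable, f(t) > 0 for all t ∈ [0,T₀), and f''(t) + b(t) f'(t) ≥ γ f(t)^p for all t ∈ [0,T₀), with f(0) > ε₀ and f'(0) ≥ A₀ ε₀. Then, setting δ₀ = γ^{1/(p−1)} ε₀ and μ = μ(p,b,β,A₀), one has f(t) ≥ ε₀ (1 − μ δ₀^{p−1} B(t))^{−2/(p−1)} for all t ∈ [0,T₀), and T₀ ≤ B⁻¹(μ⁻¹ δ₀^{1−p}). -/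
open Set

/-- The fundamental theorem of calculus for a function continuous on a closed half-line. -/
lemma hasDerivWithinAt_integral_Ici {c : ℝ → ℝ} {a : ℝ} (hc : ContinuousOn c (Ici a))
    {t : ℝ} (ht : t ∈ Ici a) :
    HasDerivWithinAt (fun x => ∫ τ in a..x, c τ) (c t) (Ici a) t := by
  have hcont : Continuous fun x => c (max x a) := by
    refine hc.comp_continuous (by fun_prop) fun x => ?_
    exact le_max_right x a
  have hder := (hcont.integral_hasStrictDerivAt a t).hasDerivAt.hasDerivWithinAt (s := Ici a)
  have hta : max t a = t := max_eq_left ht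
  simp only [hta] at hder
  have heq : ∀ x ∈ Ici a, ∫ τ in a..x, c τ = ∫ τ in a..x, c (max τ a) := by
    intro x hx
    refine intervalIntegral.integral_congr fun τ hτ => ?_
    rw [uIcc_of_le hx] at hτ
    simp [max_eq_left hτ.1]
  exact hder.congr heq (heq t ht)

lemma monotoneOn_Ico_of_hasDerivWithinAt_nonneg {a s : ℝ} {u u' : ℝ → ℝ}
    (hu : ∀ t ∈ Ico a s, HasDerivWithinAt u (u' t) (Ico a s) t)
    (hu' : ∀ t ∈ Ico a s, 0 ≤ u' t) : MonotoneOn u (Ico a s) := by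
  refine monotoneOn_of_hasDerivWithinAt_nonneg (f' := u') (convex_Ico a s)
    (fun t ht => (hu t ht).continuousWithinAt) (fun t ht => ?_) fun t ht => ?_
  · exact (hu t (interior_subset ht)).mono interior_subset
  · exact hu' t (interior_subset ht)

/-- A linear first order differential inequality preserves nonnegativity. -/
lemma nonneg_of_deriv_add_mul_nonneg {a s : ℝ} {c u u' : ℝ → ℝ}
    (hc : ContinuousOn c (Ici a))
    (hu : ∀ t ∈ Ico a s, HasDerivWithinAt u (u' t) (Ico a s) t) (hua : 0 ≤ u a)
    (h : ∀ t ∈ Ico a s, 0 ≤ u' t + c t * u t) {t : ℝ} (ht : t ∈ Ico a s) : 0 ≤ u t := by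
  have hmono : MonotoneOn (fun x => u x * Real.exp (∫ τ in a..x, c τ)) (Ico a s) := by
    refine monotoneOn_Ico_of_hasDerivWithinAt_nonneg
      (fun x hx => (hu x hx).mul
        (((hasDerivWithinAt_integral_Ici hc hx.1).mono Ico_subset_Ici_self).exp)) fun x hx => ?_
    have := mul_nonneg (h x hx) (Real.exp_pos (∫ τ in a..x, c τ)).le
    linarith
  have hle := hmono ⟨le_rfl, ht.1.trans_lt ht.2⟩ ht ht.1
  simp only [intervalIntegral.integral_same, Real.exp_zero, mul_one] at hle
  exact nonneg_of_mul_nonneg_left (hua.trans hle) (Real.exp_pos _)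

/-- Positivity for a damped second order differential inequality that is only required to hold
where the function is positive. -/
lemma pos_of_damped_ineq {a s : ℝ} {c h h' h'' : ℝ → ℝ}
    (hc : ContinuousOn c (Ici a))
    (hh : ∀ t ∈ Ico a s, HasDerivWithinAt h (h' t) (Ico a s) t)
    (hh' : ∀ t ∈ Ico a s, HasDerivWithinAt h' (h'' t) (Ico a s) t)
    (ha : 0 < h a) (ha' : 0 ≤ h' a)
    (hineq : ∀ t ∈ Ico a s, 0 < h t → 0 ≤ h'' t + c t * h' t) {t : ℝ} (ht : t ∈ Ico a s) :
    0 < h t := by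
  by_contra! hneg
  have hcont : ContinuousOn h (Icc a t) := fun x hx =>
    ((hh x ⟨hx.1, hx.2.trans_lt ht.2⟩).continuousWithinAt).mono
      fun y hy => ⟨hy.1, hy.2.trans_lt ht.2⟩
  have hclosed : IsClosed (Icc a t ∩ h ⁻¹' Iic 0) :=
    hcont.preimage_isClosed_of_isClosed isClosed_Icc isClosed_Iic
  have hne : (Icc a t ∩ h ⁻¹' Iic 0).Nonempty := ⟨t, ⟨ht.1, le_rfl⟩, hneg⟩
  have hbdd : BddBelow (Icc a t ∩ h ⁻¹' Iic 0) := ⟨a, fun x hx => hx.1.1⟩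
  have hmem := hclosed.csInf_mem hne hbdd
  set r := sInf (Icc a t ∩ h ⁻¹' Iic 0)
  have hrs : r < s := hmem.1.2.trans_lt ht.2
  have hsub : Ico a r ⊆ Ico a s := Ico_subset_Ico_right hrs.le
  have hpos : ∀ x ∈ Ico a r, 0 < h x := by
    intro x hx
    by_contra! hx0
    exact absurd (csInf_le hbdd ⟨⟨hx.1, hx.2.le.trans hmem.1.2⟩, hx0⟩) (not_le.2 hx.2)
  have hder : ∀ x ∈ Ico a r, 0 ≤ h' x := fun x hx =>
    nonneg_of_deriv_add_mul_nonneg hc (fun y hy => (hh' y (hsub hy)).mono hsub) ha'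
      (fun y hy => hineq y (hsub hy) (hpos y hy)) hx
  have hmono : MonotoneOn h (Icc a r) := by
    refine monotoneOn_of_hasDerivWithinAt_nonneg (f' := h') (convex_Icc a r)
      (hcont.mono (Icc_subset_Icc_right hmem.1.2)) (fun x hx => ?_) fun x hx => ?_
    · rw [interior_Icc] at hx ⊢
      exact (hh x (hsub (Ioo_subset_Ico_self hx))).mono (Ioo_subset_Ico_self.trans hsub)
    · rw [interior_Icc] at hx
      exact hder x (Ioo_subset_Ico_self hx)
  have hle := hmono ⟨le_rfl, hmem.1.1⟩ ⟨hmem.1.1, le_rfl⟩ hmem.1.1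
  have hr0 : h r ≤ 0 := hmem.2
  linarith

/-- The algebraic bound that controls the second derivative of the comparison function. -/
lemma mul_one_add_rpow_le_s2 {β B₄ m t : ℝ} (hβ0 : 0 < β) (hβ1 : β ≤ 1) (hB₄ : 0 < B₄)
    (hm0 : 0 < m) (hm1 : m ≤ 1) (ht : 0 ≤ t) (htB : t ≤ B₄ * (1 + m⁻¹) ^ (1 / (1 + β))) :
    m * (1 + t) ^ (2 * β) ≤ ((2:ℝ) ^ (1 / (1 + β)) * (1 + B₄)) ^ (2 * β) := by
  have hm' : 1 ≤ m⁻¹ := (one_le_inv₀ hm0).2 hm1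
  have hr : 0 ≤ 1 / (1 + β) := by positivity
  have h1 : 1 + t ≤ (2:ℝ) ^ (1 / (1 + β)) * (1 + B₄) * (m⁻¹) ^ (1 / (1 + β)) := by
    have h2 : (1 + m⁻¹) ^ (1 / (1 + β)) ≤ (2:ℝ) ^ (1 / (1 + β)) * (m⁻¹) ^ (1 / (1 + β)) := by
      rw [← Real.mul_rpow (by norm_num) (by positivity)]
      exact Real.rpow_le_rpow (by positivity) (by linarith) hr
    have h3 : (1:ℝ) ≤ (2:ℝ) ^ (1 / (1 + β)) * (m⁻¹) ^ (1 / (1 + β)) :=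
      (Real.one_le_rpow (by linarith) hr).trans h2
    nlinarith [mul_le_mul_of_nonneg_left h2 hB₄.le]
  have h4 : (1 + t) ^ (2 * β) ≤
      ((2:ℝ) ^ (1 / (1 + β)) * (1 + B₄)) ^ (2 * β) * m⁻¹ := by
    refine (Real.rpow_le_rpow (by positivity) h1 (by positivity)).trans ?_
    rw [Real.mul_rpow (by positivity) (by positivity)]
    gcongr
    rw [← Real.rpow_mul (by positivity)]
    conv_rhs => rw [← Real.rpow_one m⁻¹]
    refine Real.rpow_le_rpow_of_exponent_le hm' ?_
    rw [one_div_mul_eq_div, div_le_one (by linarith)]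
    linarith
  calc m * (1 + t) ^ (2 * β)
      ≤ m * (((2:ℝ) ^ (1 / (1 + β)) * (1 + B₄)) ^ (2 * β) * m⁻¹) := by gcongr
    _ = _ := by field_simp

/-- Blow-up rate and lifespan bound for the damped ordinary differential
inequality (Proposition 2.3). -/
theorem ode_blowup_rate_and_lifespan (T₀ A₀ β p γ ε₀ b₁ b₂ b₃ B₄ : ℝ)
    (hT₀ : 0 < T₀) (hA₀ : 0 < A₀) (hβ : β ∈ Icc (-1:ℝ) 1) (hp : 1 < p) (hγ : 0 < γ)
    (hε₀ : ε₀ ∈ Ioc (0:ℝ) (γ ^ (-(1 / (p - 1)))))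
    (hb₁ : 0 < b₁) (hb₂ : 0 < b₂) (hb₃ : 0 < b₃) (hB₄ : 0 < B₄)
    (b b' B Binv : ℝ → ℝ)
    (hbpos : ∀ t ≥ (0:ℝ), 0 < b t)
    (hbder : ∀ t ≥ (0:ℝ), HasDerivWithinAt b (b' t) (Ici 0) t)
    (hblow : ∀ t ≥ (0:ℝ), b₁ * (1 + t) ^ (-β) ≤ b t)
    (hbupp : ∀ t ≥ (0:ℝ), b t ≤ b₂ * (1 + t) ^ (-β))
    (hb'bound : ∀ t ≥ (0:ℝ), |b' t| ≤ b₃ * (1 + t)⁻¹ * b t)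
    (hB : ∀ t ≥ (0:ℝ), B t = ∫ τ in (0:ℝ)..t, (b τ)⁻¹)
    (hBmono : StrictMonoOn B (Ici 0))
    (hBinv_left : ∀ t ≥ (0:ℝ), Binv (B t) = t)
    (hBinv_right : ∀ τ ≥ (0:ℝ), 0 ≤ Binv τ ∧ B (Binv τ) = τ)
    (hBinv_bound : 0 < β → ∀ τ ≥ (0:ℝ), Binv τ ≤ B₄ * (1 + τ) ^ (1 / (1 + β)))
    (f f' f'' : ℝ → ℝ)
    (hf_der : ∀ t ∈ Ico (0:ℝ) T₀, HasDerivWithinAt f (f' t) (Ico 0 T₀) t)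
    (hf_der2 : ∀ t ∈ Ico (0:ℝ) T₀, HasDerivWithinAt f' (f'' t) (Ico 0 T₀) t)
    (hf''_cont : ContinuousOn f'' (Ico 0 T₀))
    (hf_pos : ∀ t ∈ Ico (0:ℝ) T₀, 0 < f t)
    (hf_ineq : ∀ t ∈ Ico (0:ℝ) T₀, γ * f t ^ p ≤ f'' t + b t * f' t)
    (hf0 : ε₀ < f 0) (hf'0 : A₀ * ε₀ ≤ f' 0)
    (δ₀ μ : ℝ)
    (hδ₀ : δ₀ = γ ^ (1 / (p - 1)) * ε₀)
    (hμ : μ = dampMu p (b 0) β b₁ b₃ B₄ A₀) :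
    (∀ t ∈ Ico (0:ℝ) T₀,
      ε₀ * (1 - μ * δ₀ ^ (p - 1) * B t) ^ (-(2 / (p - 1))) ≤ f t) ∧
    T₀ ≤ Binv (μ⁻¹ * δ₀ ^ (1 - p)) := by
  obtain ⟨hε, hε1⟩ := hε₀
  have hp1 : 0 < p - 1 := by linarith
  have hbcont : ContinuousOn b (Ici 0) := fun t ht => (hbder t ht).continuousWithinAt
  have hBder : ∀ t ∈ Ici (0:ℝ), HasDerivWithinAt B (b t)⁻¹ (Ici 0) t := fun t ht =>
    (hasDerivWithinAt_integral_Ici (hbcont.inv₀ fun x hx => (hbpos x hx).ne') ht).congr hB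
      (hB t ht)
  have hB0 : B 0 = 0 := by simp [hB 0 le_rfl]
  set q := 2 / (p - 1) with hq
  have hq0 : 0 < q := by positivity
  have hqp : q * p = q + 2 := by rw [hq]; field_simp; ring
  set d := δ₀ ^ (p - 1) with hd
  have hδpos : 0 < δ₀ := by rw [hδ₀]; positivity
  have hd0 : 0 < d := by positivity
  have hdε : d = γ * ε₀ ^ (p - 1) := by
    rw [hd, hδ₀, Real.mul_rpow (by positivity) hε.le, ← Real.rpow_mul hγ.le,
      one_div_mul_cancel hp1.ne', Real.rpow_one]
  have hd1 : d ≤ 1 := by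
    refine Real.rpow_le_one hδpos.le ?_ hp1.le
    rw [hδ₀]
    calc γ ^ (1 / (p - 1)) * ε₀ ≤ γ ^ (1 / (p - 1)) * γ ^ (-(1 / (p - 1))) := by gcongr
      _ = 1 := by rw [← Real.rpow_add hγ, add_neg_cancel, Real.rpow_zero]
  have hdp : γ * ε₀ ^ p = ε₀ * d := by
    rw [hdε, Real.rpow_sub_one hε.ne']; field_simp
  set K : ℝ := if 0 < β then ((2:ℝ) ^ (1 / (1 + β)) * (1 + B₄)) ^ (2 * β) else 1 with hK
  have hK0 : 0 < K := by rw [hK]; split_ifs <;> positivity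
  set S : ℝ := 2 * (p + 1) / (p - 1) ^ 2 * b₁ ^ (-(2:ℝ)) * K + 2 * (b₁⁻¹ * b₃ + 1) / (p - 1)
    with hS
  have hS0 : 0 < S := by positivity
  have hSq : S = q * (q + 1) * (b₁⁻¹ ^ 2 * K) + q * (b₁⁻¹ * b₃ + 1) := by
    have h1 : b₁ ^ (-(2:ℝ)) = b₁⁻¹ ^ 2 := by
      rw [Real.rpow_neg hb₁.le, Real.rpow_two, inv_pow]
    rw [hS, h1, hq]
    field_simp
    ring
  have hb0 := hbpos 0 le_rfl
  have hμdef : μ = min 1 (min ((p - 1) / 2 * b 0 * A₀) S⁻¹) := hμ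
  have hμ0 : 0 < μ := by
    rw [hμdef]
    exact lt_min one_pos (lt_min (by positivity) (by positivity))
  have hμ1 : μ ≤ 1 := hμdef ▸ min_le_left _ _
  have hμA : μ ≤ (p - 1) / 2 * b 0 * A₀ :=
    hμdef ▸ (min_le_right _ _).trans (min_le_left _ _)
  have hμS : μ * S ≤ 1 := by
    have : μ ≤ S⁻¹ := hμdef ▸ (min_le_right _ _).trans (min_le_right _ _)
    calc μ * S ≤ S⁻¹ * S := by gcongr
      _ = 1 := inv_mul_cancel₀ hS0.ne'
  clear_value K S q d
  set m := μ * d with hm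
  have hm0 : 0 < m := by positivity
  have hm1 : m ≤ 1 := mul_le_one₀ hμ1 hd0.le hd1
  have hminv : μ⁻¹ * δ₀ ^ (1 - p) = m⁻¹ := by
    rw [hm, mul_inv, hd, ← Real.rpow_neg hδpos.le, neg_sub]
  rw [hminv]
  obtain ⟨hT₁, hBT₁⟩ := hBinv_right m⁻¹ (by positivity)
  set T₁ := Binv m⁻¹
  have hBlt : ∀ t ∈ Ico (0:ℝ) T₁, 0 < 1 - m * B t := by
    intro t ht
    have h1 : B t < m⁻¹ := hBT₁ ▸ hBmono ht.1 hT₁ ht.2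
    have h2 : m * B t < m * m⁻¹ := by gcongr
    rw [mul_inv_cancel₀ hm0.ne'] at h2
    linarith
  have hBnonneg : ∀ t ∈ Ici (0:ℝ), 0 ≤ B t := fun t ht =>
    hB0 ▸ hBmono.monotoneOn (mem_Ici.2 le_rfl) ht ht
  have hT₁pos : 0 < T₁ := by
    refine hT₁.lt_of_ne fun h => ?_
    rw [← h, hB0] at hBT₁
    exact (inv_pos.2 hm0).ne hBT₁
  have hbβ : ∀ t ∈ Ici (0:ℝ), (b t)⁻¹ ≤ b₁⁻¹ * (1 + t) ^ β := by
    intro t ht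
    have ht' : (0:ℝ) < 1 + t := by linarith [mem_Ici.1 ht]
    have h1 := inv_anti₀ (by positivity) (hblow t ht)
    rwa [mul_inv, ← Real.rpow_neg ht'.le, neg_neg] at h1
  have hK1 : ∀ t ∈ Ico (0:ℝ) T₁, m * ((b t)⁻¹) ^ 2 ≤ b₁⁻¹ ^ 2 * K := by
    intro t ht
    have ht0 : (0:ℝ) ≤ t := ht.1
    have hbt := hbpos t ht0
    have h1 : m * (1 + t) ^ (2 * β) ≤ K := by
      rw [hK]
      split_ifs with hβ0
      · refine mul_one_add_rpow_le_s2 hβ0 hβ.2 hB₄ hm0 hm1 ht0 ?_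
        exact ht.2.le.trans (hBinv_bound hβ0 _ (by positivity))
      · exact mul_le_one₀ hm1 (by positivity)
          (Real.rpow_le_one_of_one_le_of_nonpos (by linarith) (by linarith))
    have h2 : ((b t)⁻¹) ^ 2 ≤ b₁⁻¹ ^ 2 * (1 + t) ^ (2 * β) := by
      calc ((b t)⁻¹) ^ 2 ≤ (b₁⁻¹ * (1 + t) ^ β) ^ 2 := by gcongr; exact hbβ t ht0
        _ = _ := by
          rw [mul_pow, mul_comm 2 β, Real.rpow_mul (by positivity), Real.rpow_two]
    calc m * ((b t)⁻¹) ^ 2 ≤ m * (b₁⁻¹ ^ 2 * (1 + t) ^ (2 * β)) := by gcongr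
      _ = b₁⁻¹ ^ 2 * (m * (1 + t) ^ (2 * β)) := by ring
      _ ≤ _ := by gcongr
  have hb'1 : ∀ t ∈ Ici (0:ℝ), -(b' t / b t ^ 2) ≤ b₁⁻¹ * b₃ := by
    intro t ht
    have ht0 : (0:ℝ) ≤ t := ht
    have hbt := hbpos t ht
    have h1 : -(b' t) ≤ b₃ * (1 + t)⁻¹ * b t := (neg_le_abs _).trans (hb'bound t ht)
    calc -(b' t / b t ^ 2) = -(b' t) / b t ^ 2 := by ring
      _ ≤ b₃ * (1 + t)⁻¹ * b t / b t ^ 2 := by gcongr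
      _ = b₃ * (1 + t)⁻¹ * (b t)⁻¹ := by field_simp
      _ ≤ b₃ * (1 + t)⁻¹ * (b₁⁻¹ * (1 + t) ^ β) := by gcongr; exact hbβ t ht
      _ ≤ b₃ * (1 + t)⁻¹ * (b₁⁻¹ * (1 + t) ^ (1:ℝ)) := by
        gcongr
        · linarith
        · exact hβ.2
      _ = b₁⁻¹ * b₃ := by rw [Real.rpow_one]; field_simp
  set g : ℝ → ℝ := fun t => ε₀ * (1 - m * B t) ^ (-q) with hg
  set g' : ℝ → ℝ := fun t => ε₀ * q * m * (b t)⁻¹ * (1 - m * B t) ^ (-q - 1) with hg'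
  set g'' : ℝ → ℝ := fun t => ε₀ * q * m * (-(b' t / b t ^ 2) * (1 - m * B t) ^ (-q - 1) +
    (q + 1) * m * (b t)⁻¹ ^ 2 * (1 - m * B t) ^ (-q - 2)) with hg''
  have hXder : ∀ t ∈ Ico (0:ℝ) T₁,
      HasDerivWithinAt (fun x => 1 - m * B x) (-(m * (b t)⁻¹)) (Ici 0) t := fun t ht =>
    ((hBder t ht.1).const_mul m).const_sub 1
  have hgder : ∀ t ∈ Ico (0:ℝ) T₁, HasDerivWithinAt g (g' t) (Ici 0) t := by
    intro t ht
    refine (((hXder t ht).rpow_const (p := -q) (Or.inl (hBlt t ht).ne')).const_mul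
      ε₀).congr_deriv ?_
    simp only [hg']
    ring
  have hg'der : ∀ t ∈ Ico (0:ℝ) T₁, HasDerivWithinAt g' (g'' t) (Ici 0) t := by
    intro t ht
    have hbt := hbpos t ht.1
    refine ((((hbder t ht.1).inv hbt.ne').const_mul (ε₀ * q * m)).mul
      ((hXder t ht).rpow_const (p := -q - 1) (Or.inl (hBlt t ht).ne'))).congr_deriv ?_
    simp only [hg'', Pi.inv_apply, show -q - 1 - 1 = -q - 2 by ring]
    ring
  have hgineq : ∀ t ∈ Ico (0:ℝ) T₁, g'' t + b t * g' t ≤ γ * g t ^ p := by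
    intro t ht
    have hbt := hbpos t ht.1
    have hX := hBlt t ht
    have hX1 : 1 - m * B t ≤ 1 := by
      have := mul_nonneg hm0.le (hBnonneg t ht.1)
      linarith
    set Y := (1 - m * B t) ^ (-q - 2) with hY
    have hY0 : 0 < Y := by positivity
    have hle : (1 - m * B t) ^ (-q - 1) ≤ Y :=
      Real.rpow_le_rpow_of_exponent_ge hX hX1 (by linarith)
    have hgp : γ * g t ^ p = ε₀ * d * Y := by
      simp only [hg]
      rw [Real.mul_rpow hε.le (by positivity), ← Real.rpow_mul hX.le, neg_mul, hqp, ← mul_assoc,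
        hdp, neg_add']
    have hlow : (1 - b' t / b t ^ 2) * (1 - m * B t) ^ (-q - 1) ≤ (b₁⁻¹ * b₃ + 1) * Y := by
      refine mul_le_mul ?_ hle (by positivity) (by positivity)
      linarith [hb'1 t ht.1]
    calc g'' t + b t * g' t
        = ε₀ * m * (q * (q + 1) * (m * (b t)⁻¹ ^ 2) * Y +
            q * ((1 - b' t / b t ^ 2) * (1 - m * B t) ^ (-q - 1))) := by
          simp only [hg'', hg', ← hY]
          field_simp
          ring
      _ ≤ ε₀ * m * (q * (q + 1) * (b₁⁻¹ ^ 2 * K) * Y + q * ((b₁⁻¹ * b₃ + 1) * Y)) := by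
          have := hK1 t ht
          gcongr ε₀ * m * (q * (q + 1) * ?_ * Y + q * ?_)
      _ = μ * S * (ε₀ * d * Y) := by rw [hSq, hm]; ring
      _ ≤ 1 * (ε₀ * d * Y) := by gcongr
      _ = γ * g t ^ p := by rw [hgp, one_mul]
  have hcomp : ∀ t ∈ Ico (0:ℝ) (min T₀ T₁), g t < f t := by
    intro t ht
    have h0 : Ico (0:ℝ) (min T₀ T₁) ⊆ Ico 0 T₀ := Ico_subset_Ico_right (min_le_left _ _)
    have h1 : Ico (0:ℝ) (min T₀ T₁) ⊆ Ico 0 T₁ := Ico_subset_Ico_right (min_le_right _ _)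
    refine sub_pos.1 (pos_of_damped_ineq (h := fun x => f x - g x) (h' := fun x => f' x - g' x)
      (h'' := fun x => f'' x - g'' x) hbcont
      (fun x hx => ((hf_der x (h0 hx)).mono h0).sub
        ((hgder x (h1 hx)).mono Ico_subset_Ici_self))
      (fun x hx => ((hf_der2 x (h0 hx)).mono h0).sub
        ((hg'der x (h1 hx)).mono Ico_subset_Ici_self)) ?_ ?_ ?_ ht)
    · simp only [hg, hB0, mul_zero, sub_zero, Real.one_rpow, mul_one]
      linarith
    · simp only [hg', hB0, mul_zero, sub_zero, Real.one_rpow, mul_one]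
      have h2 : q * m * (b 0)⁻¹ ≤ A₀ := by
        calc q * m * (b 0)⁻¹ ≤ q * ((p - 1) / 2 * b 0 * A₀) * (b 0)⁻¹ := by
              gcongr
              exact (mul_le_of_le_one_right hμ0.le hd1).trans hμA
          _ = A₀ := by rw [hq]; field_simp
      nlinarith [mul_le_mul_of_nonneg_left h2 hε.le]
    · intro x hx hpos
      have h3 := hf_ineq x (h0 hx)
      have h4 := hgineq x (h1 hx)
      have hX := hBlt x (h1 hx)
      have h5 : γ * g x ^ p ≤ γ * f x ^ p := by
        have : 0 ≤ g x := by simp only [hg]; positivity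
        gcongr
        linarith
      linarith
  have hT : T₀ ≤ T₁ := by
    by_contra! hlt
    have hXT : Filter.Tendsto (fun x => 1 - m * B x) (nhdsWithin T₁ (Ico 0 T₁))
        (nhdsWithin 0 (Ioi 0)) := by
      refine tendsto_nhdsWithin_iff.2 ⟨?_, ?_⟩
      · have h1 : ContinuousWithinAt (fun x => 1 - m * B x) (Ico 0 T₁) T₁ :=
          (((hBder T₁ hT₁).const_mul m).const_sub 1).continuousWithinAt.mono Ico_subset_Ici_self
        have h2 : 1 - m * B T₁ = 0 := by rw [hBT₁, mul_inv_cancel₀ hm0.ne', sub_self]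
        simpa only [ContinuousWithinAt, h2] using h1
      · exact Filter.eventually_of_mem self_mem_nhdsWithin hBlt
    have hgT : Filter.Tendsto g (nhdsWithin T₁ (Ico 0 T₁)) Filter.atTop :=
      ((tendsto_rpow_neg_nhdsGT_zero (neg_lt_zero.2 hq0)).comp hXT).const_mul_atTop hε
    have hfT : Filter.Tendsto f (nhdsWithin T₁ (Ico 0 T₁)) Filter.atTop := by
      refine Filter.tendsto_atTop_mono' _ ?_ hgT
      refine Filter.eventually_of_mem self_mem_nhdsWithin fun x hx => ?_
      exact (hcomp x (by rwa [min_eq_right hlt.le])).le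
    have hfc : Filter.Tendsto f (nhdsWithin T₁ (Ico 0 T₁)) (nhds (f T₁)) :=
      (hf_der T₁ ⟨hT₁, hlt⟩).continuousWithinAt.mono (Ico_subset_Ico_right hlt.le)
    have : (nhdsWithin T₁ (Ico 0 T₁)).NeBot := by
      rw [← mem_closure_iff_nhdsWithin_neBot, closure_Ico hT₁pos.ne]
      exact ⟨hT₁, le_rfl⟩
    exact not_tendsto_nhds_of_tendsto_atTop hfT _ hfc
  refine ⟨fun t ht => ?_, hT⟩
  exact (hcomp t (by rwa [min_eq_left hT])).le
end

section
/- Hardy-type inequality on the line (Lemma 4.2 / lem_hardy): Let f : ℝ → ℝ be measurable with ∫_ℝ (1+y²) f(y)² dy < ∞ (so f is integrable) and with ∫_ℝ f(y) dy = 0. Define F(y) = ∫_{−∞}^{y} f(z) dz. Then ∫_ℝ F(y)² dy ≤ 4 ∫_ℝ y² f(y)² dy. -/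
open MeasureTheory Set

/-- The Cauchy–Schwarz inequality for the lower Lebesgue integral. -/
theorem sq_lintegral_mul_le {α : Type*} [MeasurableSpace α] {μ : Measure α} {a b : α → ENNReal}
    (ha : AEMeasurable a μ) (hb : AEMeasurable b μ) :
    (∫⁻ x, a x * b x ∂μ) ^ 2 ≤ (∫⁻ x, a x ^ 2 ∂μ) * ∫⁻ x, b x ^ 2 ∂μ := by
  have h := ENNReal.lintegral_mul_le_Lp_mul_Lq μ Real.HolderConjugate.two_two ha hb
  have half (t : ENNReal) : (t ^ (1 / 2 : ℝ)) ^ 2 = t := by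
    rw [← ENNReal.rpow_natCast, ← ENNReal.rpow_mul]; norm_num
  simp only [Pi.mul_apply, ENNReal.rpow_two] at h
  calc _ ≤ _ := pow_le_pow_left' h 2
    _ = _ := by rw [mul_pow, half, half]

theorem lintegral_Ioi_rpow_neg_three_halves {y : ℝ} (hy : 0 < y) :
    ∫⁻ z in Ioi y, ENNReal.ofReal (z ^ (-3 / 2 : ℝ)) = ENNReal.ofReal (2 * y ^ (-1 / 2 : ℝ)) := by
  rw [← ofReal_integral_eq_lintegral_ofReal (integrableOn_Ioi_rpow_of_lt (by norm_num) hy),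
    integral_Ioi_rpow_of_lt (by norm_num) hy]
  · congr 1; norm_num; ring
  · filter_upwards [self_mem_ae_restrict measurableSet_Ioi] with z hz
    exact Real.rpow_nonneg (hy.trans hz).le _

theorem lintegral_Ioo_rpow_neg_half {z : ℝ} (hz : 0 < z) :
    ∫⁻ y in Ioo 0 z, ENNReal.ofReal (y ^ (-1 / 2 : ℝ)) = ENNReal.ofReal (2 * z ^ (1 / 2 : ℝ)) := by
  have hi : IntervalIntegrable (fun y : ℝ => y ^ (-1 / 2 : ℝ)) volume 0 z :=
    intervalIntegral.intervalIntegrable_rpow' (by norm_num)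
  rw [setLIntegral_congr Ioo_ae_eq_Ioc, ← ofReal_integral_eq_lintegral_ofReal
    ((intervalIntegrable_iff_integrableOn_Ioc_of_le hz.le).1 hi),
    ← intervalIntegral.integral_of_le hz.le, integral_rpow (by norm_num)]
  · congr 1
    rw [show (-1 / 2 : ℝ) + 1 = 1 / 2 by norm_num, Real.zero_rpow (by norm_num)]; ring
  · filter_upwards [self_mem_ae_restrict measurableSet_Ioc] with y hy
    exact Real.rpow_nonneg hy.1.le _

theorem sq_lintegral_Ioi_le {g : ℝ → ENNReal} (hg : Measurable g) {y : ℝ} (hy : 0 < y) :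
    (∫⁻ z in Ioi y, g z) ^ 2 ≤
      ENNReal.ofReal (2 * y ^ (-1 / 2 : ℝ)) *
        ∫⁻ z in Ioi y, ENNReal.ofReal (z ^ (3 / 2 : ℝ)) * g z ^ 2 := by
  have hprod : ∫⁻ z in Ioi y, g z = ∫⁻ z in Ioi y,
      ENNReal.ofReal (z ^ (-3 / 4 : ℝ)) * (ENNReal.ofReal (z ^ (3 / 4 : ℝ)) * g z) := by
    refine setLIntegral_congr_fun measurableSet_Ioi fun z hz => ?_
    have hz : 0 < z := hy.trans hz
    rw [← mul_assoc, ← ENNReal.ofReal_mul (by positivity), ← Real.rpow_add hz]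
    norm_num
  rw [hprod]
  refine (sq_lintegral_mul_le (by fun_prop) (by fun_prop)).trans_eq ?_
  rw [← lintegral_Ioi_rpow_neg_three_halves hy]
  congr 1
  · refine setLIntegral_congr_fun measurableSet_Ioi fun z hz => ?_
    have hz : 0 < z := hy.trans hz
    rw [← ENNReal.ofReal_pow (by positivity), ← Real.rpow_mul_natCast hz.le]
    norm_num
  · refine setLIntegral_congr_fun measurableSet_Ioi fun z hz => ?_
    have hz : 0 < z := hy.trans hz
    rw [mul_pow, ← ENNReal.ofReal_pow (by positivity), ← Real.rpow_mul_natCast hz.le]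
    norm_num

/-- Tonelli's theorem on the region `0 < y < z`. -/
theorem lintegral_Ioi_mul_lintegral_Ioi {u v : ℝ → ENNReal} (hu : Measurable u)
    (hv : Measurable v) :
    ∫⁻ y in Ioi 0, u y * ∫⁻ z in Ioi y, v z = ∫⁻ z in Ioi 0, (∫⁻ y in Ioo 0 z, u y) * v z := by
  have hS : MeasurableSet {p : ℝ × ℝ | 0 < p.1 ∧ p.1 < p.2} :=
    (measurableSet_lt measurable_const measurable_fst).inter
      (measurableSet_lt measurable_fst measurable_snd)
  let k : ℝ → ℝ → ENNReal := fun y z =>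
    {p : ℝ × ℝ | 0 < p.1 ∧ p.1 < p.2}.indicator (fun p => u p.1 * v p.2) (y, z)
  have hk : Measurable (Function.uncurry k) :=
    Measurable.indicator (by fun_prop) hS
  have hleft : ∫⁻ y in Ioi 0, u y * ∫⁻ z in Ioi y, v z = ∫⁻ y, ∫⁻ z, k y z := by
    rw [← lintegral_indicator measurableSet_Ioi]
    refine lintegral_congr fun y => ?_
    by_cases hy : 0 < y
    · rw [indicator_of_mem (mem_Ioi.2 hy), ← lintegral_const_mul _ hv,
        ← lintegral_indicator measurableSet_Ioi]
      refine lintegral_congr fun z => ?_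
      simp [k, indicator, hy]
    · simp [k, indicator, hy]
  have hright : ∫⁻ z in Ioi 0, (∫⁻ y in Ioo 0 z, u y) * v z = ∫⁻ z, ∫⁻ y, k y z := by
    rw [← lintegral_indicator measurableSet_Ioi]
    refine lintegral_congr fun z => ?_
    by_cases hz : 0 < z
    · rw [indicator_of_mem (mem_Ioi.2 hz), ← lintegral_mul_const _ hu,
        ← lintegral_indicator measurableSet_Ioo]
      refine lintegral_congr fun y => ?_
      simp [k, indicator]
    · have (y : ℝ) : ¬ (0 < y ∧ y < z) := fun h => hz (h.1.trans h.2)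
      simp [k, indicator, hz, this]
  rw [hleft, hright, lintegral_lintegral_swap hk.aemeasurable]

/-- The dual Hardy inequality on the half-line. -/
theorem lintegral_Ioi_sq_lintegral_Ioi_le {g : ℝ → ENNReal} (hg : Measurable g) :
    ∫⁻ y in Ioi 0, (∫⁻ z in Ioi y, g z) ^ 2 ≤
      4 * ∫⁻ z in Ioi 0, ENNReal.ofReal (z ^ 2) * g z ^ 2 := by
  calc ∫⁻ y in Ioi 0, (∫⁻ z in Ioi y, g z) ^ 2
      ≤ ∫⁻ y in Ioi 0, ENNReal.ofReal (2 * y ^ (-1 / 2 : ℝ)) *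
          ∫⁻ z in Ioi y, ENNReal.ofReal (z ^ (3 / 2 : ℝ)) * g z ^ 2 :=
        setLIntegral_mono' measurableSet_Ioi fun y hy => sq_lintegral_Ioi_le hg hy
    _ = ∫⁻ z in Ioi 0, (∫⁻ y in Ioo 0 z, ENNReal.ofReal (2 * y ^ (-1 / 2 : ℝ))) *
          (ENNReal.ofReal (z ^ (3 / 2 : ℝ)) * g z ^ 2) :=
        lintegral_Ioi_mul_lintegral_Ioi (by fun_prop) (by fun_prop)
    _ = ∫⁻ z in Ioi 0, 4 * (ENNReal.ofReal (z ^ 2) * g z ^ 2) := by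
        refine setLIntegral_congr_fun measurableSet_Ioi fun z hz => ?_
        have hz : 0 < z := hz
        simp only [ENNReal.ofReal_mul zero_le_two]
        rw [lintegral_const_mul _ (by fun_prop), lintegral_Ioo_rpow_neg_half hz, ← mul_assoc,
          ← mul_assoc, ← ENNReal.ofReal_mul zero_le_two, ← ENNReal.ofReal_mul (by positivity),
          show (4 : ENNReal) = ENNReal.ofReal 4 by simp, ← ENNReal.ofReal_mul (by norm_num)]
        congr 2
        have h : z ^ (1 / 2 : ℝ) * z ^ (3 / 2 : ℝ) = z ^ 2 := by
          rw [← Real.rpow_add hz]; norm_num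
        linear_combination 4 * h
    _ = _ := lintegral_const_mul _ (by fun_prop)

theorem lintegral_eq_lintegral_Ioi_add_lintegral_Ioi_neg (h : ℝ → ENNReal) :
    ∫⁻ y, h y = (∫⁻ y in Ioi 0, h y) + ∫⁻ y in Ioi 0, h (-y) := by
  have hneg : ∫⁻ y in Ioi 0, h (-y) = ∫⁻ y in Iio 0, h y := by
    have := (Measure.measurePreserving_neg (volume : Measure ℝ)).setLIntegral_comp_preimage_emb
      (MeasurableEquiv.neg ℝ).measurableEmbedding h (Iio 0)
    simpa using this
  rw [hneg, ← lintegral_add_compl h (measurableSet_Ioi (a := (0 : ℝ))), compl_Ioi,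
    restrict_Iio_eq_restrict_Iic]

/-- Hardy-type inequality on the line (Lemma 4.2 / lem_hardy). -/
theorem hardy_inequality (f : ℝ → ℝ) (hmeas : Measurable f)
    (hweight : Integrable (fun y => (1 + y ^ 2) * f y ^ 2))
    (hint : Integrable f)
    (hzero : (∫ y, f y) = 0) :
    (∫ y, (∫ z in Iic y, f z) ^ 2) ≤ 4 * ∫ y, y ^ 2 * f y ^ 2 := by
  have hright (y : ℝ) : ‖(∫ z in Iic y, f z) ^ 2‖ₑ ≤ (∫⁻ z in Ioi y, ‖f z‖ₑ) ^ 2 := by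
    have h := integral_add_compl (measurableSet_Iic (a := y)) hint
    rw [hzero, compl_Iic] at h
    rw [eq_neg_of_add_eq_zero_left h, enorm_pow, enorm_neg]
    exact pow_le_pow_left' (enorm_integral_le_lintegral_enorm _) 2
  have hleft (y : ℝ) : ‖(∫ z in Iic (-y), f z) ^ 2‖ₑ ≤ (∫⁻ z in Ioi y, ‖f (-z)‖ₑ) ^ 2 := by
    rw [← integral_comp_neg_Ioi, enorm_pow]
    exact pow_le_pow_left' (enorm_integral_le_lintegral_enorm _) 2
  have hmain : ∫⁻ y, ‖(∫ z in Iic y, f z) ^ 2‖ₑ ≤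
      4 * ∫⁻ y, ENNReal.ofReal (y ^ 2) * ‖f y‖ₑ ^ 2 := by
    rw [lintegral_eq_lintegral_Ioi_add_lintegral_Ioi_neg,
      lintegral_eq_lintegral_Ioi_add_lintegral_Ioi_neg
        (fun y => ENNReal.ofReal (y ^ 2) * ‖f y‖ₑ ^ 2), mul_add]
    simp only [neg_sq]
    exact add_le_add
      ((lintegral_mono hright).trans (lintegral_Ioi_sq_lintegral_Ioi_le (by fun_prop)))
      ((lintegral_mono hleft).trans (lintegral_Ioi_sq_lintegral_Ioi_le (by fun_prop)))
  have hsq : Integrable (fun y => y ^ 2 * f y ^ 2) := by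
    refine hweight.mono' (by fun_prop) (.of_forall fun y => ?_)
    rw [Real.norm_of_nonneg (by positivity)]
    nlinarith [sq_nonneg (f y)]
  have hnonneg : 0 ≤ ∫ y, y ^ 2 * f y ^ 2 := integral_nonneg fun y => by positivity
  rw [← ENNReal.ofReal_le_ofReal_iff (by positivity), ENNReal.ofReal_mul (by norm_num),
    ofReal_integral_eq_lintegral_ofReal hsq (.of_forall fun y => by positivity)]
  calc ENNReal.ofReal (∫ y, (∫ z in Iic y, f z) ^ 2)
      = ‖∫ y, (∫ z in Iic y, f z) ^ 2‖ₑ :=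
        (Real.enorm_of_nonneg (integral_nonneg fun y => sq_nonneg _)).symm
    _ ≤ ∫⁻ y, ‖(∫ z in Iic y, f z) ^ 2‖ₑ := enorm_integral_le_lintegral_enorm _
    _ ≤ _ := hmain
    _ = _ := by
        congr 1
        · simp
        · refine lintegral_congr fun y => ?_
          rw [ENNReal.ofReal_mul (sq_nonneg y), ← enorm_pow, Real.enorm_of_nonneg (sq_nonneg _)]
end

section
/- Bootstrap lemma in the subcritical case (core of the proof of Proposition 1.5 / prop_low): Let n ≥ 1, 1 < p < p_F with p_F = 1 + 2/n, and let C₀ > 0, I₀ > 0 and s₀ ≥ 0. Then there exists a constant c = c(n,p,C₀,I₀) > 0 with the following property: for every ε > 0 and every S₁ ≥ s₀, if M : [s₀,S₁] → ℝ is continuous and satisfies M(s) ≤ C₀ ε² I₀ + C₀ ( e^{n(p_F−p)s} M(s)^p + e^{(n/2)(p_F−p)s} M(s)^{(p+1)/2} ) for all s ∈ [s₀,S₁], M(s) ≥ 0 on [s₀,S₁], and M(S₁) = 2 C₀ ε² I₀, then ε^{−2(p−1)/(n(p_F−p))} ≤ c · e^{S₁}. -/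
open Set

/-- Bootstrap lemma in the subcritical case (core of the proof of
Proposition 1.5 / prop_low), with Fujita exponent `p_F = 1 + 2/n`. -/
theorem bootstrap_subcritical (n : ℕ) (hn : 1 ≤ n) (p C₀ I₀ s₀ : ℝ)
    (hp : 1 < p) (hpF : p < 1 + 2 / (n : ℝ))
    (hC₀ : 0 < C₀) (hI₀ : 0 < I₀) (hs₀ : 0 ≤ s₀) :
    ∃ c > (0:ℝ), ∀ ε > (0:ℝ), ∀ S₁ ≥ s₀, ∀ M : ℝ → ℝ,
      ContinuousOn M (Icc s₀ S₁) →
      (∀ s ∈ Icc s₀ S₁,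
        M s ≤ C₀ * ε ^ 2 * I₀ +
          C₀ * (Real.exp ((n : ℝ) * ((1 + 2 / (n : ℝ)) - p) * s) * M s ^ p +
            Real.exp ((n : ℝ) / 2 * ((1 + 2 / (n : ℝ)) - p) * s) * M s ^ ((p + 1) / 2))) →
      (∀ s ∈ Icc s₀ S₁, 0 ≤ M s) →
      M S₁ = 2 * C₀ * ε ^ 2 * I₀ →
      ε ^ (-(2 * (p - 1) / ((n : ℝ) * ((1 + 2 / (n : ℝ)) - p)))) ≤ c * Real.exp S₁ := by
  have hn0 : (0:ℝ) < n := by exact_mod_cast hn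
  have ha : 0 < (n : ℝ) * ((1 + 2 / (n : ℝ)) - p) := mul_pos hn0 (by linarith)
  have hhalf : (n : ℝ) / 2 * ((1 + 2 / (n : ℝ)) - p) =
      (n : ℝ) * ((1 + 2 / (n : ℝ)) - p) / 2 := by ring
  rw [hhalf]
  generalize (n : ℝ) * ((1 + 2 / (n : ℝ)) - p) = a at ha ⊢
  set δ : ℝ := min 1 (1 / (4 * C₀)) with hδdef
  have hδ : 0 < δ := lt_min one_pos (by positivity)
  set K : ℝ := (2 * C₀ * I₀) ^ ((p - 1) / 2) with hK
  have hKpos : 0 < K := by positivity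
  refine ⟨(K / δ) ^ (2 / a), by positivity, ?_⟩
  intro ε hε S₁ hS M _ hM _ hMS
  have hm : 0 < M S₁ := by rw [hMS]; positivity
  have hM₁ := hM S₁ ⟨hS, le_rfl⟩
  generalize M S₁ = m at hm hMS hM₁
  have hexp : Real.exp (a * S₁) = Real.exp (a / 2 * S₁) ^ 2 := by
    rw [← Real.exp_nat_mul]; congr 1; push_cast; ring
  have hmp : m ^ p = m * (m ^ ((p - 1) / 2)) ^ 2 := by
    rw [← Real.rpow_mul_natCast hm.le]
    nth_rewrite 2 [← Real.rpow_one m]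
    rw [← Real.rpow_add hm]; congr 1; push_cast; ring
  have hmp' : m ^ ((p + 1) / 2) = m * m ^ ((p - 1) / 2) := by
    nth_rewrite 2 [← Real.rpow_one m]
    rw [← Real.rpow_add hm]; congr 1; ring
  have hmK : m ^ ((p - 1) / 2) = K * ε ^ (p - 1) := by
    have h : m = (2 * C₀ * I₀) * ε ^ 2 := by rw [hMS]; ring
    rw [h, Real.mul_rpow (by positivity) (by positivity), ← Real.rpow_natCast_mul hε.le]
    congr 2; push_cast; ring
  have hquad : 1 / 2 ≤ C₀ * ((Real.exp (a / 2 * S₁) * m ^ ((p - 1) / 2)) ^ 2 +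
      Real.exp (a / 2 * S₁) * m ^ ((p - 1) / 2)) := by
    rw [hexp, hmp, hmp'] at hM₁
    refine le_of_mul_le_mul_left ?_ hm
    linarith
  have hlower : δ ≤ Real.exp (a / 2 * S₁) * m ^ ((p - 1) / 2) := by
    have hy : 0 < Real.exp (a / 2 * S₁) * m ^ ((p - 1) / 2) := by positivity
    by_contra! hlt
    generalize Real.exp (a / 2 * S₁) * m ^ ((p - 1) / 2) = y at hquad hy hlt
    have h₁ : y < 1 := hlt.trans_le (min_le_left _ _)
    have h₂ : y * (4 * C₀) < 1 :=
      (lt_div_iff₀ (by positivity)).1 (hlt.trans_le (min_le_right _ _))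
    have h₃ : C₀ * y ^ 2 ≤ C₀ * y := by gcongr; nlinarith
    linarith
  have hbase : ε ^ (-(p - 1)) ≤ K / δ * Real.exp (a / 2 * S₁) := by
    rw [hmK] at hlower
    have he : 0 < ε ^ (p - 1) := by positivity
    rw [Real.rpow_neg hε.le, inv_le_iff_one_le_mul₀ he, div_mul_eq_mul_div,
      div_mul_eq_mul_div, le_div_iff₀ hδ]
    linarith
  calc ε ^ (-(2 * (p - 1) / a)) = (ε ^ (-(p - 1))) ^ (2 / a) := by
        rw [← Real.rpow_mul hε.le]; congr 1; ring
    _ ≤ (K / δ * Real.exp (a / 2 * S₁)) ^ (2 / a) := by gcongr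
    _ = (K / δ) ^ (2 / a) * Real.exp S₁ := by
        rw [Real.mul_rpow (by positivity) (by positivity), ← Real.exp_mul]
        congr 2; field_simp
end

section
/- Bootstrap lemma in the critical case (core of the proof of Proposition 1.7 / prop_lowcr): Let n ≥ 1, p = p_F = 1 + 2/n, and let C₀ > 0, I₀ > 0 and s₀ ≥ 0. Then there exists a constant c = c(p,C₀,I₀) > 0 with the following property: for every ε > 0 with 2 C₀ ε² I₀ ≤ 1 and every S₁ ≥ s₀, if M : [s₀,S₁] → ℝ is continuous, nonnegative, and satisfies M(s) ≤ C₀ ε² I₀ + C₀ (s − s₀)( M(s)^p + M(s)^{(p+1)/2} ) for all s ∈ [s₀,S₁], and M(S₁) = 2 C₀ ε² I₀, then S₁ − s₀ ≥ c · ε^{−(p−1)}. -/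
open Set

/-- Bootstrap lemma in the critical case (core of the proof of
Proposition 1.7 / prop_lowcr), with `p = p_F = 1 + 2/n`. -/
theorem bootstrap_critical (n : ℕ) (hn : 1 ≤ n) (p C₀ I₀ s₀ : ℝ)
    (hp : p = 1 + 2 / (n : ℝ))
    (hC₀ : 0 < C₀) (hI₀ : 0 < I₀) (hs₀ : 0 ≤ s₀) :
    ∃ c > (0:ℝ), ∀ ε > (0:ℝ), 2 * C₀ * ε ^ 2 * I₀ ≤ 1 → ∀ S₁ ≥ s₀, ∀ M : ℝ → ℝ,
      ContinuousOn M (Icc s₀ S₁) →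
      (∀ s ∈ Icc s₀ S₁, 0 ≤ M s) →
      (∀ s ∈ Icc s₀ S₁,
        M s ≤ C₀ * ε ^ 2 * I₀ + C₀ * (s - s₀) * (M s ^ p + M s ^ ((p + 1) / 2))) →
      M S₁ = 2 * C₀ * ε ^ 2 * I₀ →
      c * ε ^ (-(p - 1)) ≤ S₁ - s₀ := by
  have hp1 : 1 < p := by
    have : (0:ℝ) < n := by exact_mod_cast hn
    have : 0 < 2 / (n : ℝ) := by positivity
    linarith
  refine ⟨(2 * C₀ * I₀) ^ (-(p - 1) / 2) / (4 * C₀), by positivity, ?_⟩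
  intro ε hε hsmall S₁ hS M _ _ hM hMS
  have hbound := hM S₁ ⟨hS, le_rfl⟩
  obtain ⟨m, hm⟩ : ∃ m, m = M S₁ := ⟨_, rfl⟩
  rw [← hm] at hbound hMS
  have hm0 : 0 < m := by rw [hMS]; positivity
  have hm1 : m ≤ 1 := hMS ▸ hsmall
  have hpow : m ^ p ≤ m ^ ((p + 1) / 2) :=
    Real.rpow_le_rpow_of_exponent_ge hm0 hm1 (by linarith)
  have hT : 0 ≤ C₀ * (S₁ - s₀) := mul_nonneg hC₀.le (sub_nonneg.2 hS)
  have hm_le : m ≤ 4 * C₀ * (S₁ - s₀) * m ^ ((p + 1) / 2) := by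
    have := mul_le_mul_of_nonneg_left hpow hT
    linarith
  have hm_eq : m ^ (-(p - 1) / 2) * m ^ ((p + 1) / 2) = m := by
    rw [← Real.rpow_add hm0]
    convert Real.rpow_one m using 2
    ring
  have hm_rpow_le : m ^ (-(p - 1) / 2) ≤ 4 * C₀ * (S₁ - s₀) :=
    le_of_mul_le_mul_right (hm_eq.le.trans hm_le) (by positivity)
  have hm_rpow : m ^ (-(p - 1) / 2) = (2 * C₀ * I₀) ^ (-(p - 1) / 2) * ε ^ (-(p - 1)) := by
    rw [hMS, show 2 * C₀ * ε ^ 2 * I₀ = (2 * C₀ * I₀) * ε ^ 2 by ring,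
      Real.mul_rpow (by positivity) (by positivity), ← Real.rpow_natCast ε 2,
      ← Real.rpow_mul hε.le]
    congr 2
    push_cast
    ring
  rw [div_mul_eq_mul_div, ← hm_rpow, div_le_iff₀ (by positivity)]
  linarith
end

section
/- Key inequality in the proof of Lemma 2.2 (case β ∈ (0,1]): Let β ∈ (0,1], p > 1, b₁ > 0, ε₀ ∈ (0,1] and μ ∈ (0,1]. Let b : [0,∞) → ℝ be continuous with b(t) ≥ b₁(1+t)^{−β} for all t ≥ 0, let B(t) = ∫₀^t b(τ)^{−1} dτ be a strictly increasing bijection of [0,∞) onto itself, and assume its inverse satisfies B⁻¹(τ) ≤ B₄(1+τ)^{1/(1+β)} for all τ ≥ 0 for some constant B₄ > 0. Set T₁ = B⁻¹(μ⁻¹ ε₀^{1−p}). Then for all t ∈ [0,T₁), ε₀^{p−1} b(t)^{−2} μ ≤ 2^{2β/(1+β)} b₁^{−2} (1+B₄)^{2β}. -/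
open Set

/-- Key inequality in the proof of Lemma 2.2 (case β ∈ (0,1]). -/
theorem key_inequality_beta_pos (β p b₁ ε₀ μ B₄ : ℝ)
    (hβ : β ∈ Ioc (0:ℝ) 1) (hp : 1 < p) (hb₁ : 0 < b₁)
    (hε₀ : ε₀ ∈ Ioc (0:ℝ) 1) (hμ : μ ∈ Ioc (0:ℝ) 1) (hB₄ : 0 < B₄)
    (b B Binv : ℝ → ℝ)
    (hb_cont : ContinuousOn b (Ici 0))
    (hb_pos : ∀ t ≥ (0:ℝ), 0 < b t)
    (hb_low : ∀ t ≥ (0:ℝ), b₁ * (1 + t) ^ (-β) ≤ b t)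
    (hB : ∀ t ≥ (0:ℝ), B t = ∫ τ in (0:ℝ)..t, (b τ)⁻¹)
    (hB_mono : StrictMonoOn B (Ici 0))
    (hBinv_left : ∀ t ≥ (0:ℝ), Binv (B t) = t)
    (hBinv_right : ∀ τ ≥ (0:ℝ), 0 ≤ Binv τ ∧ B (Binv τ) = τ)
    (hBinv_bound : ∀ τ ≥ (0:ℝ), Binv τ ≤ B₄ * (1 + τ) ^ (1 / (1 + β))) :
    ∀ t, 0 ≤ t → t < Binv (μ⁻¹ * ε₀ ^ (1 - p)) →
      ε₀ ^ (p - 1) * b t ^ (-(2:ℝ)) * μ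
        ≤ 2 ^ (2 * β / (1 + β)) * b₁ ^ (-(2:ℝ)) * (1 + B₄) ^ (2 * β) := by
  obtain ⟨hβ0, hβ1⟩ := hβ
  obtain ⟨hε0, hε1⟩ := hε₀
  obtain ⟨hμ0, hμ1⟩ := hμ
  intro t ht htT
  set s : ℝ := μ⁻¹ * ε₀ ^ (1 - p) with hs
  have hs1 : 1 ≤ s :=
    one_le_mul_of_one_le_of_one_le ((one_le_inv₀ hμ0).2 hμ1)
      (Real.one_le_rpow_of_pos_of_le_one_of_nonpos hε0 hε1 (by linarith))
  have hs0 : 0 < s := by linarith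
  have hs_inv : ε₀ ^ (p - 1) * μ = s⁻¹ := by
    rw [hs, mul_inv, inv_inv, ← Real.rpow_neg hε0.le, neg_sub, mul_comm]
  have hb_sq : b t ^ (-(2:ℝ)) ≤ b₁ ^ (-(2:ℝ)) * (1 + t) ^ (2 * β) := by
    have hpow : 0 < (1 + t) ^ (-β) := by positivity
    calc b t ^ (-(2:ℝ)) ≤ (b₁ * (1 + t) ^ (-β)) ^ (-(2:ℝ)) :=
          Real.rpow_le_rpow_of_nonpos (by positivity) (hb_low t ht) (by norm_num)
      _ = b₁ ^ (-(2:ℝ)) * (1 + t) ^ (2 * β) := by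
          rw [Real.mul_rpow hb₁.le hpow.le, ← Real.rpow_mul (by linarith)]
          congr 2
          ring
  have ht_le : 1 + t ≤ (1 + B₄) * (2 * s) ^ (1 / (1 + β)) := by
    have hone : 1 ≤ (2 * s) ^ (1 / (1 + β)) :=
      Real.one_le_rpow (by linarith) (by positivity)
    have hmono : (1 + s) ^ (1 / (1 + β)) ≤ (2 * s) ^ (1 / (1 + β)) :=
      Real.rpow_le_rpow (by linarith) (by linarith) (by positivity)
    have hbound := htT.le.trans (hBinv_bound s hs0.le)
    have := mul_le_mul_of_nonneg_left hmono hB₄.le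
    linarith
  have ht_pow : (1 + t) ^ (2 * β)
      ≤ (1 + B₄) ^ (2 * β) * (2 ^ (2 * β / (1 + β)) * s) := by
    calc (1 + t) ^ (2 * β) ≤ ((1 + B₄) * (2 * s) ^ (1 / (1 + β))) ^ (2 * β) :=
          Real.rpow_le_rpow (by linarith) ht_le (by positivity)
      _ = (1 + B₄) ^ (2 * β) * (2 ^ (2 * β / (1 + β)) * s ^ (2 * β / (1 + β))) := by
          rw [Real.mul_rpow (by positivity) (by positivity), ← Real.rpow_mul (by positivity),
            one_div_mul_eq_div, Real.mul_rpow (by norm_num) hs0.le]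
      _ ≤ (1 + B₄) ^ (2 * β) * (2 ^ (2 * β / (1 + β)) * s) := by
          gcongr
          exact Real.rpow_le_self_of_one_le hs1 ((div_le_one (by linarith)).2 (by linarith))
  calc ε₀ ^ (p - 1) * b t ^ (-(2:ℝ)) * μ = s⁻¹ * b t ^ (-(2:ℝ)) := by rw [← hs_inv]; ring
    _ ≤ s⁻¹ * (b₁ ^ (-(2:ℝ)) * ((1 + B₄) ^ (2 * β) * (2 ^ (2 * β / (1 + β)) * s))) := by
        gcongr
        exact hb_sq.trans (by gcongr)
    _ = 2 ^ (2 * β / (1 + β)) * b₁ ^ (-(2:ℝ)) * (1 + B₄) ^ (2 * β) := by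
        field_simp
end
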